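/- arXiv:1810.08235 — 2 statements merged into one kernel-verified Lean document; each statement's English description precedes it below -/
import Mathlib

section
/- For integers m ≥ n ≥ 1 and p, q ≥ 0, the convolution sequence (r_i)_{i≥1} is unimodal if and only if at least one of the following holds: (i) m > q, (ii) n > p, (iii) m = 2 and n = 2, or (iv) n = 1. -/
/-- The sequence of `p` ones followed by the binomial coefficients
`choose m 0, …, choose m m` and then zeros (indexed from 1; the value at 0 is 0). -/
def broomSeq (m p : ℕ) : ℕ → ℕ := fun i =>
  if 1 ≤ i ∧ i ≤ p then 1
  else if p + 1 ≤ i ∧ i ≤ p + m + 1 then Nat.choose m (i - p - 1)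
  else 0

/-- The convolution `r_i = ∑_{j=1}^{i} s_j * t_{i+1-j}` of the two broom sequences. -/
def convSeq (m n p q : ℕ) : ℕ → ℕ := fun i =>
  ∑ j ∈ Finset.Icc 1 i, broomSeq m p j * broomSeq n q (i + 1 - j)

/-- A sequence (indexed from 1) is unimodal if for some `k ≥ 1` it is
nondecreasing up to `k` and nonincreasing from `k` on. -/
def Unimodal (a : ℕ → ℕ) : Prop :=
  ∃ k : ℕ, 1 ≤ k ∧ (∀ i, 1 ≤ i → i < k → a i ≤ a (i + 1)) ∧ (∀ i, k ≤ i → a (i + 1) ≤ a i)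

open Polynomial in
/-- The generating polynomial of `broomSeq m p`, with exponents shifted down by one. -/
noncomputable def broomPoly (m p : ℕ) : ℤ[X] :=
  ∑ i ∈ Finset.range p, X ^ i + X ^ p * (1 + X) ^ m

lemma broomPoly_coeff (m p k : ℕ) : (broomPoly m p).coeff k = broomSeq m p (k + 1) := by
  simp only [broomPoly, broomSeq, Polynomial.coeff_add, Polynomial.finsetSum_coeff,
    Polynomial.coeff_X_pow, Polynomial.coeff_X_pow_mul', Polynomial.coeff_one_add_X_pow,
    Finset.sum_ite_eq, Finset.mem_range]
  rcases lt_or_ge k p with h | h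
  · rw [if_pos h, if_neg (by omega), if_pos (by omega)]; simp
  · rw [if_neg (by omega), if_pos h, if_neg (by omega)]
    rcases le_or_gt k (p + m) with h' | h'
    · rw [if_pos (by omega), show k + 1 - p - 1 = k - p by omega]; simp
    · rw [if_neg (by omega), Nat.choose_eq_zero_of_lt (by omega)]; simp

lemma convSeq_eq_coeff (m n p q k : ℕ) :
    (convSeq m n p q (k + 1) : ℤ) = (broomPoly m p * broomPoly n q).coeff k := by
  rw [Polynomial.coeff_mul, Finset.Nat.sum_antidiagonal_eq_sum_range_succ_mk, convSeq,
    ← Finset.Ico_succ_right_eq_Icc, Finset.sum_Ico_eq_sum_range]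
  push_cast
  refine Finset.sum_congr (by simp) fun i hi => ?_
  have : i ≤ k := by simpa [Nat.lt_succ_iff] using hi
  rw [broomPoly_coeff, broomPoly_coeff, add_comm 1 i,
    show k + 1 + 1 - (i + 1) = k - i + 1 by omega]

/-- The coefficient of `x ^ j` in `(1 - x) * (1 + x) ^ N`. -/
def chooseDiff (N j : ℕ) : ℤ := N.choose j - if j = 0 then 0 else (N.choose (j - 1) : ℤ)

lemma chooseDiff_zero (N : ℕ) : chooseDiff N 0 = 1 := by simp [chooseDiff]

lemma chooseDiff_succ (N j : ℕ) : chooseDiff N (j + 1) = N.choose (j + 1) - N.choose j := by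
  simp [chooseDiff]

lemma chooseDiff_succ_succ (N j : ℕ) :
    chooseDiff (N + 1) (j + 1) = chooseDiff N (j + 1) + chooseDiff N j := by
  cases j with
  | zero => simp [chooseDiff]
  | succ j =>
    simp only [chooseDiff_succ, Nat.choose_succ_succ, Nat.succ_eq_add_one]
    push_cast; ring

lemma chooseDiff_nonneg {N j : ℕ} (h : 2 * j ≤ N) : 0 ≤ chooseDiff N j := by
  cases j with
  | zero => simp [chooseDiff]
  | succ j =>
    have := Nat.choose_le_succ_of_lt_half_left (r := j) (n := N) (by omega)
    rw [chooseDiff_succ]; omega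

lemma chooseDiff_nonpos {N j : ℕ} (h : N < 2 * j) : chooseDiff N j ≤ 0 := by
  cases j with
  | zero => omega
  | succ j =>
    rw [chooseDiff_succ]
    rcases lt_or_ge N (j + 1) with h' | h'
    · rw [Nat.choose_eq_zero_of_lt h']; simp
    · rw [← Nat.choose_symm h', ← Nat.choose_symm (show j ≤ N by omega),
        show N - j = N - (j + 1) + 1 by omega]
      rcases eq_or_ne N (2 * j + 1) with h2 | h2
      · subst h2
        rw [show 2 * j + 1 - (j + 1) = j by omega, Nat.choose_symm_half]; simp
      · have := Nat.choose_le_succ_of_lt_half_left (r := N - (j + 1)) (n := N) (by omega)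
        omega

lemma two_le_chooseDiff_two_mul {j : ℕ} (hj : 2 ≤ j) : 2 ≤ chooseDiff (2 * j) j := by
  induction j, hj using Nat.le_induction with
  | base => decide
  | succ j hj ih =>
    obtain ⟨i, rfl⟩ : ∃ i, j = i + 1 := ⟨j - 1, by omega⟩
    have h1 : chooseDiff (2 * (i + 1) + 1) (i + 1 + 1) = 0 := by
      rw [chooseDiff_succ, Nat.choose_symm_half]; simp
    have h2 : 0 ≤ chooseDiff (2 * (i + 1)) i := chooseDiff_nonneg (by omega)
    rw [show 2 * (i + 1 + 1) = 2 * (i + 1) + 1 + 1 by ring, chooseDiff_succ_succ, h1,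
      chooseDiff_succ_succ]
    omega

/-- The coefficient of `x ^ j` in `(1 - x) * (1 + x) ^ (m + n) - (1 + x) ^ m - (1 + x) ^ n`. -/
def chooseExcess (m n j : ℕ) : ℤ := chooseDiff (m + n) j - m.choose j - n.choose j

lemma chooseExcess_comm (m n j : ℕ) : chooseExcess m n j = chooseExcess n m j := by
  unfold chooseExcess; rw [add_comm m n]; ring

lemma chooseExcess_one (m n : ℕ) : chooseExcess m n 1 = -1 := by
  simp [chooseExcess, chooseDiff]; ring

lemma chooseExcess_two (m n : ℕ) : chooseExcess m n 2 = m * n - m - n := by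
  have h : ((m + n).choose 2 : ℤ) = m.choose 2 + n.choose 2 + m * n := by
    induction n with
    | zero => simp
    | succ n ih =>
      rw [← add_assoc, Nat.choose_succ_succ' (m + n) 1, Nat.choose_succ_succ' n 1]
      push_cast
      rw [ih]
      simp
      ring
  simp [chooseExcess, chooseDiff, h]; ring

lemma chooseExcess_succ_left (m n j : ℕ) :
    chooseExcess (m + 1) n (j + 1) =
      chooseExcess m n (j + 1) + chooseExcess m n j + n.choose j := by
  unfold chooseExcess
  rw [show m + 1 + n = m + n + 1 by ring, chooseDiff_succ_succ, Nat.choose_succ_succ' m j]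
  push_cast; ring

lemma chooseExcess_nonneg {j : ℕ} (hj : 2 ≤ j) :
    ∀ {m n : ℕ}, j ≤ m → j ≤ n → 0 ≤ chooseExcess m n j := by
  obtain ⟨i, rfl⟩ : ∃ i, j = i + 1 := ⟨j - 1, by omega⟩
  induction i with
  | zero => omega
  | succ i ih =>
    have add_nonneg_prev {m n : ℕ} (hm : i + 1 + 1 ≤ m) (hn : i + 1 + 1 ≤ n) :
        0 ≤ chooseExcess m n (i + 1) + n.choose (i + 1) := by
      rcases Nat.eq_zero_or_pos i with rfl | hi
      · rw [chooseExcess_one]; simp; omega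
      · have := ih (by omega) (m := m) (n := n) (by omega) (by omega)
        positivity
    have succ_left {m n : ℕ} (hm : i + 1 + 1 ≤ m) (hn : i + 1 + 1 ≤ n)
        (h : 0 ≤ chooseExcess m n (i + 1 + 1)) : 0 ≤ chooseExcess (m + 1) n (i + 1 + 1) := by
      rw [chooseExcess_succ_left]
      linarith [add_nonneg_prev hm hn]
    intro m n hm hn
    have diag : 0 ≤ chooseExcess (i + 1 + 1) (i + 1 + 1) (i + 1 + 1) := by
      have := two_le_chooseDiff_two_mul hj
      rw [chooseExcess, ← two_mul, Nat.choose_self]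
      push_cast; linarith
    induction m, hm using Nat.le_induction with
    | base =>
      induction n, hn using Nat.le_induction with
      | base => exact diag
      | succ n hn ihn =>
        rw [chooseExcess_comm] at ihn ⊢
        exact succ_left hn le_rfl ihn
    | succ m hm ihm => exact succ_left hm hn ihm

lemma chooseDiff_mul_choose_sub (m n j : ℕ) (hj : j ≤ m) :
    ((j : ℤ) + 1) * (m + n + 1 - j) *
      (chooseDiff (m + n) (j + 1) * m.choose j - chooseDiff (m + n) j * m.choose (j + 1)) =
    (m + n).choose j * m.choose j * (2 * j * n - (m + n + 1) * (n - 1)) * (-1) := by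
  have h1 : ((m + n).choose (j + 1) : ℤ) * (j + 1) = (m + n).choose j * (m + n - j) := by
    have := Nat.choose_succ_right_eq (m + n) j
    zify [show j ≤ m + n by omega] at this
    exact this
  have h2 : (m.choose (j + 1) : ℤ) * (j + 1) = m.choose j * (m - j) := by
    have := Nat.choose_succ_right_eq m j
    zify [hj] at this
    exact this
  have h3 : chooseDiff (m + n) j * (m + n + 1 - j) = (m + n).choose j * (m + n + 1 - 2 * j) := by
    cases j with
    | zero => simp [chooseDiff]
    | succ i =>
      have := Nat.choose_succ_right_eq (m + n) i
      zify [show i ≤ m + n by omega] at this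
      rw [chooseDiff_succ]
      push_cast
      linear_combination this
  rw [chooseDiff_succ]
  linear_combination (m.choose j : ℤ) * (m + n + 1 - j) * h1 -
    chooseDiff (m + n) j * (m + n + 1 - j) * h2 - (m.choose j : ℤ) * (m - j) * h3

lemma choose_succ_mul_choose_le (m q j : ℕ) :
    m.choose (q + j + 1) * m.choose j ≤ m.choose (q + j) * m.choose (j + 1) := by
  have h1 := Nat.choose_succ_right_eq m (q + j)
  have h2 := Nat.choose_succ_right_eq m j
  refine Nat.le_of_mul_le_mul_right (c := (q + j + 1) * (j + 1)) ?_ (by positivity)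
  calc m.choose (q + j + 1) * m.choose j * ((q + j + 1) * (j + 1))
      = m.choose (q + j + 1) * (q + j + 1) * m.choose j * (j + 1) := by ring
    _ = m.choose (q + j) * m.choose j * ((m - (q + j)) * (j + 1)) := by rw [h1]; ring
    _ ≤ m.choose (q + j) * m.choose j * ((m - j) * (q + j + 1)) := by
        gcongr <;> omega
    _ = m.choose (q + j) * (m.choose j * (m - j)) * (q + j + 1) := by ring
    _ = m.choose (q + j) * m.choose (j + 1) * ((q + j + 1) * (j + 1)) := by rw [← h2]; ring

/-- The `k`-th coefficient of `(1 - x)` times the generating polynomial of `convSeq m n p q`. -/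
noncomputable def convDiff (m n p q k : ℕ) : ℤ :=
  ((1 - Polynomial.X) * (broomPoly m p * broomPoly n q)).coeff k

lemma convDiff_succ (m n p q k : ℕ) :
    convDiff m n p q (k + 1) = convSeq m n p q (k + 1 + 1) - convSeq m n p q (k + 1) := by
  rw [convDiff, sub_mul, one_mul, Polynomial.coeff_sub, Polynomial.coeff_X_mul,
    convSeq_eq_coeff, convSeq_eq_coeff]

lemma coeff_one_sub_X_mul_one_add_X_pow (N j : ℕ) :
    ((1 - Polynomial.X) * (1 + Polynomial.X) ^ N : Polynomial ℤ).coeff j = chooseDiff N j := by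
  rw [sub_mul, one_mul, Polynomial.coeff_sub]
  cases j with
  | zero => simp [chooseDiff, Polynomial.coeff_one_add_X_pow]
  | succ j =>
    rw [Polynomial.coeff_X_mul, chooseDiff_succ, Polynomial.coeff_one_add_X_pow,
      Polynomial.coeff_one_add_X_pow]

open Polynomial in
lemma convDiff_eq (m n p q k : ℕ) :
    convDiff m n p q k =
      (if k < q then 1 else 0) - (if p ≤ k then if k - p < q then 1 else 0 else 0)
      + (if q ≤ k then (n.choose (k - q) : ℤ) else 0)
      - (if p + q ≤ k then (n.choose (k - (p + q)) : ℤ) else 0)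
      + (if p ≤ k then (m.choose (k - p) : ℤ) else 0)
      - (if p + q ≤ k then (m.choose (k - (p + q)) : ℤ) else 0)
      + (if p + q ≤ k then chooseDiff (m + n) (k - (p + q)) else 0) := by
  have hp : (1 - X : ℤ[X]) * ∑ i ∈ Finset.range p, X ^ i = 1 - X ^ p := mul_neg_geom_sum X p
  have hq : (1 - X : ℤ[X]) * ∑ i ∈ Finset.range q, X ^ i = 1 - X ^ q := mul_neg_geom_sum X q
  have key : (1 - X : ℤ[X]) * (broomPoly m p * broomPoly n q) =
      ∑ i ∈ Finset.range q, X ^ i - X ^ p * ∑ i ∈ Finset.range q, X ^ i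
      + X ^ q * (1 + X) ^ n - X ^ (p + q) * (1 + X) ^ n
      + X ^ p * (1 + X) ^ m - X ^ (p + q) * (1 + X) ^ m
      + X ^ (p + q) * ((1 - X) * (1 + X) ^ (m + n)) := by
    unfold broomPoly
    linear_combination (∑ i ∈ Finset.range q, X ^ i + X ^ q * (1 + X) ^ n) * hp
      + X ^ p * (1 + X) ^ m * hq
  rw [convDiff, key]
  simp only [coeff_add, coeff_sub, coeff_X_pow_mul', coeff_one_sub_X_mul_one_add_X_pow,
    coeff_one_add_X_pow, finsetSum_coeff, coeff_X_pow, Finset.sum_ite_eq, Finset.mem_range]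

lemma convDiff_of_lt {m n p q k : ℕ} (hk : k < p + q) :
    convDiff m n p q k =
      (if k < q then 1 else 0) - (if p ≤ k then 1 else 0)
      + (if q ≤ k then (n.choose (k - q) : ℤ) else 0)
      + (if p ≤ k then (m.choose (k - p) : ℤ) else 0) := by
  rw [convDiff_eq]
  simp only [if_neg (show ¬ p + q ≤ k by omega)]
  by_cases h : p ≤ k
  · simp only [if_pos h, if_pos (show k - p < q by omega)]; ring
  · simp only [if_neg h]; ring

lemma convDiff_add (m n p q j : ℕ) :
    convDiff m n p q (p + q + j) =
      chooseExcess m n j + n.choose (p + j) + m.choose (q + j) := by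
  rw [convDiff_eq, if_neg (show ¬ p + q + j < q by omega),
    if_pos (show p ≤ p + q + j by omega), if_neg (show ¬ p + q + j - p < q by omega),
    if_pos (show q ≤ p + q + j by omega), if_pos (show p ≤ p + q + j by omega),
    if_pos (show p + q ≤ p + q + j by omega), if_pos (show p + q ≤ p + q + j by omega),
    if_pos (show p + q ≤ p + q + j by omega), show p + q + j - q = p + j by omega,
    show p + q + j - p = q + j by omega, show p + q + j - (p + q) = j by omega, chooseExcess]
  ring

lemma lt_of_convDiff_neg {m n p q k : ℕ} (hk : k < p + q) (h : convDiff m n p q k < 0) :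
    q + n < k ∧ p + m < k := by
  rw [convDiff_of_lt hk] at h
  have hpk : p ≤ k := by
    by_contra hpk
    simp only [if_neg hpk] at h
    split_ifs at h <;> omega
  have hqk : q ≤ k := by
    by_contra hqk
    simp only [if_neg hqk, if_pos hpk, if_pos (not_le.1 hqk)] at h
    omega
  simp only [if_pos hpk, if_pos hqk, if_neg (not_lt.2 hqk)] at h
  constructor
  · by_contra hc
    have := Nat.choose_pos (n := n) (k := k - q) (by omega)
    omega
  · by_contra hc
    have := Nat.choose_pos (n := m) (k := k - p) (by omega)
    omega

lemma convDiff_nonpos_of_lt {m n p q k : ℕ} (hk : k < p + q) (hq : q + n < k) (hp : p + m < k) :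
    convDiff m n p q k ≤ 0 := by
  rw [convDiff_of_lt hk, if_neg (by omega), if_pos (by omega), if_pos (by omega),
    if_pos (by omega), Nat.choose_eq_zero_of_lt (by omega : n < k - q),
    Nat.choose_eq_zero_of_lt (by omega : m < k - p)]
  simp

lemma unimodal_of_diff {a : ℕ → ℕ} {d : ℕ → ℤ}
    (hd : ∀ k, d (k + 1) = a (k + 1 + 1) - a (k + 1))
    (hsign : ∀ i j, i < j → d i < 0 → d j ≤ 0) {K : ℕ} (hK : ∀ j, K ≤ j → d j ≤ 0) :
    Unimodal a := by
  have hd' : ∀ i, 1 ≤ i → d i = a (i + 1) - a i := fun i hi => by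
    obtain ⟨k, rfl⟩ : ∃ k, i = k + 1 := ⟨i - 1, by omega⟩
    exact hd k
  by_cases h : ∃ k, 1 ≤ k ∧ d k < 0
  · classical
    refine ⟨Nat.find h, (Nat.find_spec h).1, fun i hi hik => ?_, fun i hi => ?_⟩
    · have := Nat.find_min h hik
      have := hd' i hi
      omega
    · have h1 := (Nat.find_spec h).1
      have := hd' i (by omega)
      rcases hi.eq_or_lt with e | hlt
      · have := e ▸ (Nat.find_spec h).2
        omega
      · have := hsign _ _ hlt (Nat.find_spec h).2
        omega
  · push Not at h
    refine ⟨K + 1, by omega, fun i hi _ => ?_, fun i hi => ?_⟩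
    · have := hd' i hi
      have := h i hi
      omega
    · have := hd' i (by omega)
      have := hK i (by omega)
      omega

lemma not_unimodal_of_diff {a : ℕ → ℕ} {i : ℕ} (hi : 1 ≤ i) (h1 : a (i + 1) < a i)
    (h2 : a (i + 1) < a (i + 1 + 1)) : ¬ Unimodal a := by
  rintro ⟨k, _, hinc, hdec⟩
  rcases lt_or_ge i k with h | h
  · have := hinc i hi h; omega
  · have := hdec (i + 1) (by omega); omega

lemma convDiff_add_nonpos_of_lt {m n p q j : ℕ} (hmn : n ≤ m) (hj : m < j) :
    convDiff m n p q (p + q + j) ≤ 0 := by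
  rw [convDiff_add, chooseExcess, Nat.choose_eq_zero_of_lt hj,
    Nat.choose_eq_zero_of_lt (by omega : n < j), Nat.choose_eq_zero_of_lt (by omega : n < p + j),
    Nat.choose_eq_zero_of_lt (by omega : m < q + j)]
  have := chooseDiff_nonpos (N := m + n) (j := j) (by omega)
  push_cast; linarith

lemma unimodal_convSeq {m n p q : ℕ} (hmn : n ≤ m)
    (hsign : ∀ i j, i < j → convDiff m n p q (p + q + i) < 0 →
      convDiff m n p q (p + q + j) ≤ 0)
    (hlarge : n + 1 < p → m + 1 < q → ∀ j, convDiff m n p q (p + q + j) ≤ 0) :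
    Unimodal (convSeq m n p q) := by
  refine unimodal_of_diff (convDiff_succ m n p q) (K := p + q + (m + 1)) ?_ ?_
  · intro i j hij hi
    rcases lt_or_ge i (p + q) with hi' | hi'
    · have := lt_of_convDiff_neg hi' hi
      rcases lt_or_ge j (p + q) with hj' | hj'
      · exact convDiff_nonpos_of_lt hj' (by omega) (by omega)
      · obtain ⟨l, rfl⟩ := Nat.exists_eq_add_of_le hj'
        exact hlarge (by omega) (by omega) l
    · obtain ⟨l, rfl⟩ := Nat.exists_eq_add_of_le hi'
      obtain ⟨l', rfl⟩ := Nat.exists_eq_add_of_le (show p + q ≤ j by omega)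
      exact hsign l l' (by omega) hi
  · intro j hj
    obtain ⟨l, rfl⟩ := Nat.exists_eq_add_of_le (show p + q ≤ j by omega)
    exact convDiff_add_nonpos_of_lt hmn (by omega)

lemma le_chooseDiff_or_le {m n : ℕ} (hn : 1 ≤ n) (hmn : n ≤ m) {j : ℕ} (hj : n ≤ j) (hjm : j ≤ m) :
    (m.choose j : ℤ) ≤ chooseDiff (m + n) j ∨ ((m : ℤ) + n + 1) * (n - 1) ≤ 2 * j * n := by
  induction j, hj using Nat.le_induction with
  | base =>
    rcases hn.eq_or_lt with rfl | hn
    · right; simp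
    · left
      have := chooseExcess_nonneg hn hmn le_rfl
      rw [chooseExcess] at this
      have : (0 : ℤ) ≤ n.choose n := by positivity
      linarith
  | succ j hj ih =>
    have ih := ih (by omega)
    by_cases hdec : ((m : ℤ) + n + 1) * (n - 1) ≤ 2 * j * n
    · right; push_cast; nlinarith
    · left
      have ih := ih.resolve_right hdec
      have id := chooseDiff_mul_choose_sub m n j (by omega)
      have hM : (0 : ℤ) < m.choose j := by exact_mod_cast Nat.choose_pos (by omega)
      have hpos : (0 : ℤ) < ((j : ℤ) + 1) * (m + n + 1 - j) := by
        have : (j : ℤ) ≤ m := by omega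
        apply mul_pos <;> linarith
      have hrhs : (0 : ℤ) ≤
          (m + n).choose j * m.choose j * (2 * j * n - (m + n + 1) * (n - 1)) * (-1) := by
        have : (0 : ℤ) ≤ (m + n).choose j * m.choose j := by positivity
        nlinarith
      have hdiff := nonneg_of_mul_nonneg_right (id ▸ hrhs) hpos
      have hle : (m.choose j : ℤ) * m.choose (j + 1) ≤ chooseDiff (m + n) j * m.choose (j + 1) :=
        mul_le_mul_of_nonneg_right ih (by positivity)
      refine le_of_mul_le_mul_left (a := (m.choose j : ℤ)) ?_ hM
      linarith

lemma convDiff_add_nonneg {m n p q j : ℕ} (hmn : n ≤ m) (h : q < m ∨ p < n)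
    (hj : j ≤ 1 ∨ j ≤ n) : 0 ≤ convDiff m n p q (p + q + j) := by
  rw [convDiff_add]
  rcases le_or_gt 2 j with h2 | h2
  · have := chooseExcess_nonneg (j := j) (m := m) (n := n) h2 (by omega) (by omega)
    positivity
  · have hex : chooseExcess m n j = -1 := by
      rcases (by omega : j = 0 ∨ j = 1) with rfl | rfl
      · simp [chooseExcess, chooseDiff]
      · exact chooseExcess_one m n
    rw [hex]
    rcases h with h | h
    · have := Nat.choose_pos (n := m) (k := q + j) (by omega)
      omega
    · have := Nat.choose_pos (n := n) (k := p + j) (by omega)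
      omega

lemma convDiff_add_succ_neg {m n p q j : ℕ} (hn : 1 ≤ n) (hmn : n ≤ m) (h : q < m ∨ p < n)
    (hjm : j + 1 ≤ m) (hneg : convDiff m n p q (p + q + j) < 0) :
    convDiff m n p q (p + q + (j + 1)) < 0 := by
  have hnj : n < j := by
    by_contra hc
    exact absurd (convDiff_add_nonneg hmn h (Or.inr (not_lt.1 hc))) (not_le.2 hneg)
  rw [convDiff_add, chooseExcess, Nat.choose_eq_zero_of_lt (by omega : n < j),
    Nat.choose_eq_zero_of_lt (by omega : n < p + j)] at hneg
  rw [convDiff_add, chooseExcess, Nat.choose_eq_zero_of_lt (by omega : n < j + 1),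
    Nat.choose_eq_zero_of_lt (by omega : n < p + (j + 1)), ← add_assoc q]
  push_cast at hneg ⊢
  have hq : (0 : ℤ) ≤ m.choose (q + j) := by positivity
  have hdec := (le_chooseDiff_or_le hn hmn hnj.le (by omega)).resolve_left (by linarith)
  have id := chooseDiff_mul_choose_sub m n j (by omega)
  have hM : (0 : ℤ) < m.choose j := by exact_mod_cast Nat.choose_pos (by omega)
  have hM' : (0 : ℤ) < m.choose (j + 1) := by exact_mod_cast Nat.choose_pos hjm
  have hpos : (0 : ℤ) < ((j : ℤ) + 1) * (m + n + 1 - j) := by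
    have : (j : ℤ) ≤ m := by omega
    apply mul_pos <;> linarith
  have hrhs : ((m + n).choose j : ℤ) * m.choose j *
      (2 * j * n - (m + n + 1) * (n - 1)) * (-1) ≤ 0 := by
    have : (0 : ℤ) ≤ (m + n).choose j * m.choose j := by positivity
    nlinarith
  have hdiff := nonpos_of_mul_nonpos_right (id ▸ hrhs) hpos
  have hlog : (m.choose (q + j + 1) : ℤ) * m.choose j ≤ m.choose (q + j) * m.choose (j + 1) := by
    exact_mod_cast choose_succ_mul_choose_le m q j
  have hprod := mul_neg_of_neg_of_pos hneg hM'
  refine neg_of_mul_neg_left (b := (m.choose j : ℤ)) ?_ hM.le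
  linarith

lemma unimodal_convSeq_of_lt {m n p q : ℕ} (hn : 1 ≤ n) (hmn : n ≤ m) (h : q < m ∨ p < n) :
    Unimodal (convSeq m n p q) := by
  refine unimodal_convSeq hmn (fun i j hij hi => ?_) (by omega)
  rcases lt_or_ge m j with hj | hj
  · exact convDiff_add_nonpos_of_lt hmn hj
  · have neg_of_le : ∀ l, i ≤ l → l ≤ m → convDiff m n p q (p + q + l) < 0 := by
      intro l hl
      induction l, hl using Nat.le_induction with
      | base => exact fun _ => hi
      | succ l hl ih => exact fun hlm => convDiff_add_succ_neg hn hmn h hlm (ih (by omega))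
    exact (neg_of_le j hij.le hj).le

lemma chooseExcess_succ_nonpos {m n : ℕ} (h : (m = 2 ∧ n = 2) ∨ n = 1) (j : ℕ) :
    chooseExcess m n (j + 1) ≤ 0 := by
  rcases h with ⟨rfl, rfl⟩ | rfl
  · rcases lt_or_ge j 2 with hj | hj
    · interval_cases j <;> decide
    · rw [chooseExcess, Nat.choose_eq_zero_of_lt (by omega : 2 < j + 1)]
      have := chooseDiff_nonpos (N := 2 + 2) (j := j + 1) (by omega)
      push_cast; linarith
  · have := Nat.choose_le_choose j (show m ≤ m + 1 by omega)
    rw [chooseExcess, chooseDiff_succ, Nat.choose_succ_succ' m j]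
    push_cast
    omega

lemma unimodal_convSeq_of_small {m n p q : ℕ} (hmn : n ≤ m) (hp : n ≤ p) (hq : m ≤ q)
    (h : (m = 2 ∧ n = 2) ∨ n = 1) : Unimodal (convSeq m n p q) := by
  have hsucc : ∀ j, convDiff m n p q (p + q + (j + 1)) ≤ 0 := fun j => by
    rw [convDiff_add, Nat.choose_eq_zero_of_lt (by omega : n < p + (j + 1)),
      Nat.choose_eq_zero_of_lt (by omega : m < q + (j + 1))]
    simpa using chooseExcess_succ_nonpos h j
  refine unimodal_convSeq hmn (fun i j hij _ => ?_) (fun hp' hq' j => ?_)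
  · obtain ⟨l, rfl⟩ : ∃ l, j = l + 1 := ⟨j - 1, by omega⟩
    exact hsucc l
  · cases j with
    | zero =>
      rw [convDiff_add, Nat.choose_eq_zero_of_lt (by omega : n < p + 0),
        Nat.choose_eq_zero_of_lt (by omega : m < q + 0)]
      simp [chooseExcess, chooseDiff]
    | succ j => exact hsucc j

lemma not_unimodal_convSeq {m n p q : ℕ} (hn : 2 ≤ n) (hm : 3 ≤ m) (hp : n ≤ p) (hq : m ≤ q) :
    ¬ Unimodal (convSeq m n p q) := by
  have h1 : convDiff m n p q (p + q + 1) = -1 := by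
    rw [convDiff_add, Nat.choose_eq_zero_of_lt (by omega : n < p + 1),
      Nat.choose_eq_zero_of_lt (by omega : m < q + 1), chooseExcess_one]
    simp
  have h2 : 0 < convDiff m n p q (p + q + 2) := by
    rw [convDiff_add, Nat.choose_eq_zero_of_lt (by omega : n < p + 2),
      Nat.choose_eq_zero_of_lt (by omega : m < q + 2), chooseExcess_two]
    push_cast
    nlinarith
  rw [convDiff_succ] at h1 h2
  exact not_unimodal_of_diff (i := p + q + 1) (by omega) (by omega) (by omega)

theorem conv_unimodal_iff (m n p q : ℕ) (hn : 1 ≤ n) (hmn : n ≤ m) :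
    Unimodal (convSeq m n p q) ↔
      q < m ∨ p < n ∨ (m = 2 ∧ n = 2) ∨ n = 1 := by
  constructor
  · intro h
    by_contra hc
    exact not_unimodal_convSeq (by omega) (by omega) (by omega) (by omega) h
  · intro h
    by_cases hlt : q < m ∨ p < n
    · exact unimodal_convSeq_of_lt hn hmn hlt
    · exact unimodal_convSeq_of_small hmn (by omega) (by omega) (by omega)
end

section
/- For integers m, n, p, q ≥ 1, if q < m or p < n, then the convolution sequence (r_i)_{i≥1} is unimodal. -/
/-- A sequence of integers that is nonnegative up to some index and nonpositive from there on. -/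
def SingleSignChange (a : ℕ → ℤ) : Prop :=
  ∃ J : ℕ, (∀ k < J, 0 ≤ a k) ∧ ∀ k, J ≤ k → a k ≤ 0

/-- Repeatedly adding a sequence to its shift preserves a single sign change, provided the
first entries stay nonnegative. -/
theorem SingleSignChange.of_pascal {b : ℕ → ℕ → ℤ} (N : ℕ)
    (hb : ∀ i k, b (i + 1) (k + 1) = b i (k + 1) + b i k)
    (h_first : ∀ i ≤ N, 0 ≤ b i 0) (h_zero : SingleSignChange (b 0)) :
    SingleSignChange (b N) := by
  induction N with
  | zero => exact h_zero
  | succ N ih =>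
    obtain ⟨J, h_nonneg, h_nonpos⟩ := ih fun i hi => h_first i (by omega)
    have h_lt : ∀ k < J, 0 ≤ b (N + 1) k := by
      rintro (_ | k) hk
      · exact h_first _ le_rfl
      · rw [hb]
        exact add_nonneg (h_nonneg _ hk) (h_nonneg _ (by omega))
    have h_gt : ∀ k, J + 1 ≤ k → b (N + 1) k ≤ 0 := by
      rintro (_ | k) hk
      · omega
      · rw [hb]
        exact add_nonpos (h_nonpos _ (by omega)) (h_nonpos _ (by omega))
    rcases le_total 0 (b (N + 1) J) with hJ | hJ
    · refine ⟨J + 1, fun k hk => ?_, h_gt⟩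
      rcases Nat.lt_succ_iff_lt_or_eq.mp hk with hk | rfl
      exacts [h_lt k hk, hJ]
    · refine ⟨J, h_lt, fun k hk => ?_⟩
      rcases hk.eq_or_lt with rfl | hk
      exacts [hJ, h_gt k hk]

theorem singleSignChange_choose_sub (m : ℕ) :
    SingleSignChange fun k => (m.choose (k + 1) : ℤ) - m.choose k := by
  refine ⟨m / 2, fun k hk => ?_, fun k hk => ?_⟩
  · have := Nat.choose_le_succ_of_lt_half_left hk
    simp only
    omega
  · have : m.choose (k + 1) ≤ m.choose k := by
      rcases le_or_gt (k + 1) m with hkm | hkm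
      · rw [← Nat.choose_symm hkm, ← Nat.choose_symm (show k ≤ m by omega),
          show m - k = m - (k + 1) + 1 by omega]
        rcases Nat.lt_or_ge (m - (k + 1)) (m / 2) with h | h
        · exact Nat.choose_le_succ_of_lt_half_left h
        · rw [← Nat.choose_symm_of_eq_add (show m = (m - (k + 1)) + (m - (k + 1) + 1) by omega)]
      · simp [Nat.choose_eq_zero_of_lt hkm]
    simp only
    omega

theorem singleSignChange_choose_diff (m c p : ℕ) (hm : 1 ≤ m) :
    SingleSignChange fun k => (c.choose (k + 1 + p) : ℤ) - c.choose (k + 1)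
      + ((c + m).choose (k + 1) - (c + m).choose k) := by
  refine SingleSignChange.of_pascal (b := fun c k => (c.choose (k + 1 + p) : ℤ)
    - c.choose (k + 1) + ((c + m).choose (k + 1) - (c + m).choose k)) c ?_ ?_ ?_
  · intro i k
    simp only [show i + 1 + m = i + m + 1 by ring, show k + 1 + 1 + p = k + 1 + p + 1 by ring,
      Nat.choose_succ_succ']
    push_cast
    ring
  · intro i _
    simp only [zero_add, Nat.choose_one_right, Nat.choose_zero_right]
    push_cast
    omega
  · simpa [show ∀ k, k + 1 + p = (k + p) + 1 by intro k; ring] using singleSignChange_choose_sub m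

/-- The increment of the convolution sequence at position `p + q + k + 1`. -/
def convTailDiff (m n p q k : ℕ) : ℤ :=
  (n.choose (k + 1 + p) : ℤ) + m.choose (k + 1 + q) - m.choose (k + 1) - n.choose (k + 1)
    + ((m + n).choose (k + 1) - (m + n).choose k)

theorem convTailDiff_swap (m n p q : ℕ) : convTailDiff m n p q = convTailDiff n m q p := by
  funext k
  simp only [convTailDiff, add_comm m n]
  ring

theorem singleSignChange_convTailDiff_of_le {m n p q : ℕ} (hm : 1 ≤ m) (hmn : m ≤ n)
    (h : q < m ∨ p < n) : SingleSignChange (convTailDiff m n p q) := by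
  obtain ⟨c, rfl⟩ := Nat.exists_eq_add_of_le' hmn
  have key := SingleSignChange.of_pascal (b := fun i k => ((c + i).choose (k + 1 + p) : ℤ)
    + i.choose (k + 1 + q) - i.choose (k + 1) - (c + i).choose (k + 1)
    + ((i + (c + m)).choose (k + 1) - (i + (c + m)).choose k)) m ?_ ?_ ?_
  · exact key
  · intro i k
    simp only [show i + 1 + (c + m) = i + (c + m) + 1 by ring, ← add_assoc c i 1,
      show k + 1 + 1 + p = k + 1 + p + 1 by ring, show k + 1 + 1 + q = k + 1 + q + 1 by ring,
      Nat.choose_succ_succ']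
    push_cast
    ring
  · intro i hi
    have h_pos : i = m → 0 < (c + i).choose (0 + 1 + p) ∨ 0 < i.choose (0 + 1 + q) := by
      rintro rfl
      rcases h with h | h
      exacts [Or.inr (Nat.choose_pos (by omega)), Or.inl (Nat.choose_pos (by omega))]
    simp only [zero_add, Nat.choose_one_right, Nat.choose_zero_right] at h_pos ⊢
    push_cast
    omega
  · simpa [show ∀ k, k + 1 + q = (k + q) + 1 by intro k; ring] using
      singleSignChange_choose_diff m c p hm

theorem singleSignChange_convTailDiff {m n p q : ℕ} (hm : 1 ≤ m) (hn : 1 ≤ n)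
    (h : q < m ∨ p < n) : SingleSignChange (convTailDiff m n p q) := by
  rcases le_total m n with hmn | hmn
  · exact singleSignChange_convTailDiff_of_le hm hmn h
  · rw [convTailDiff_swap]
    exact singleSignChange_convTailDiff_of_le hn hmn h.symm

theorem coeff_broomPoly (m p i : ℕ) : (broomPoly m p).coeff i = broomSeq m p (i + 1) := by
  simp only [broomPoly, broomSeq, Polynomial.coeff_add, Polynomial.finsetSum_coeff,
    Polynomial.coeff_X_pow, Polynomial.coeff_X_pow_mul', Polynomial.coeff_one_add_X_pow,
    Finset.sum_ite_eq, Finset.mem_range]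
  rcases Nat.lt_or_ge i p with hi | hi
  · simp [hi, Nat.succ_le_of_lt hi]
  · rw [if_neg (by omega), if_pos hi, if_neg (by omega), show i + 1 - p - 1 = i - p by omega]
    split_ifs with h
    · simp
    · simp [Nat.choose_eq_zero_of_lt (show m < i - p by omega)]

theorem coeff_broomPoly_mul (m n p q i : ℕ) :
    (broomPoly m p * broomPoly n q).coeff i = convSeq m n p q (i + 1) := by
  rw [Polynomial.coeff_mul, Finset.Nat.sum_antidiagonal_eq_sum_range_succ_mk, convSeq]
  push_cast
  refine Finset.sum_nbij' (· + 1) (· - 1) ?_ ?_ ?_ ?_ ?_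
  · intro j hj
    simp only [Finset.mem_range, Finset.mem_Icc] at hj ⊢
    omega
  · intro j hj
    simp only [Finset.mem_range, Finset.mem_Icc] at hj ⊢
    omega
  · intro j _
    simp
  · intro j hj
    exact Nat.sub_add_cancel (Finset.mem_Icc.mp hj).1
  · intro j hj
    have hj' := Finset.mem_range.mp hj
    rw [coeff_broomPoly, coeff_broomPoly, show i + 1 + 1 - (j + 1) = i - j + 1 by omega]

open Polynomial in
theorem one_sub_X_mul_broomPoly_mul (m n p q : ℕ) :
    (1 - X) * (broomPoly m p * broomPoly n q)
      = ∑ i ∈ Finset.range q, X ^ i - X ^ p * ∑ i ∈ Finset.range q, X ^ i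
        + X ^ q * (1 + X) ^ n - X ^ (p + q) * (1 + X) ^ n
        + X ^ p * (1 + X) ^ m - X ^ (p + q) * (1 + X) ^ m
        + X ^ (p + q) * (1 + X) ^ (m + n) - X * (X ^ (p + q) * (1 + X) ^ (m + n)) := by
  have hp := mul_neg_geom_sum (X : ℤ[X]) p
  have hq := mul_neg_geom_sum (X : ℤ[X]) q
  simp only [broomPoly]
  linear_combination (∑ i ∈ Finset.range q, X ^ i + X ^ q * (1 + X) ^ n) * hp
    + X ^ p * (1 + X) ^ m * hq

theorem convSeq_succ_sub (m n p q i : ℕ) :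
    (convSeq m n p q (i + 2) : ℤ) - convSeq m n p q (i + 1)
      = (if i + 1 < q then 1 else 0) - (if p ≤ i + 1 ∧ i + 1 < p + q then 1 else 0)
        + (if q ≤ i + 1 then (n.choose (i + 1 - q) : ℤ) else 0)
        - (if p + q ≤ i + 1 then (n.choose (i + 1 - (p + q)) : ℤ) else 0)
        + (if p ≤ i + 1 then (m.choose (i + 1 - p) : ℤ) else 0)
        - (if p + q ≤ i + 1 then (m.choose (i + 1 - (p + q)) : ℤ) else 0)
        + (if p + q ≤ i + 1 then ((m + n).choose (i + 1 - (p + q)) : ℤ) else 0)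
        - (if p + q ≤ i then ((m + n).choose (i - (p + q)) : ℤ) else 0) := by
  have h := congrArg (fun f => Polynomial.coeff f (i + 1)) (one_sub_X_mul_broomPoly_mul m n p q)
  simp only [sub_mul, one_mul, Polynomial.coeff_sub, Polynomial.coeff_add,
    Polynomial.coeff_X_mul, coeff_broomPoly_mul, Polynomial.finsetSum_coeff,
    Polynomial.coeff_X_pow, Polynomial.coeff_X_pow_mul', Polynomial.coeff_one_add_X_pow,
    Finset.sum_ite_eq, Finset.mem_range] at h
  rw [h]
  congr 7
  split_ifs <;> first | rfl | omega

theorem convSeq_tail_sub (m n p q k : ℕ) :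
    (convSeq m n p q (p + q + 1 + k + 1) : ℤ) - convSeq m n p q (p + q + 1 + k)
      = convTailDiff m n p q k := by
  have h := convSeq_succ_sub m n p q (p + q + k)
  rw [if_neg (by omega), if_neg (by omega), if_pos (by omega), if_pos (by omega),
    if_pos (by omega), if_pos (by omega), if_pos (by omega), if_pos (by omega),
    show p + q + k + 1 - q = k + 1 + p by omega, show p + q + k + 1 - p = k + 1 + q by omega,
    show p + q + k + 1 - (p + q) = k + 1 by omega, show p + q + k - (p + q) = k by omega] at h
  rw [show p + q + 1 + k + 1 = p + q + k + 2 by ring, show p + q + 1 + k = p + q + k + 1 by ring,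
    h, convTailDiff]
  ring

theorem convSeq_le_succ {m n p q i : ℕ} (h : q < m ∨ p < n) (hi : 1 ≤ i) (hipq : i ≤ p + q) :
    convSeq m n p q i ≤ convSeq m n p q (i + 1) := by
  obtain ⟨i, rfl⟩ := Nat.exists_eq_add_of_le' hi
  have h_sub := convSeq_succ_sub m n p q i
  have h_pos : p ≤ i + 1 → q ≤ i + 1 →
      0 < n.choose (i + 1 - q) ∨ 0 < m.choose (i + 1 - p) := by
    intro _ _
    rcases h with h | h
    exacts [Or.inr (Nat.choose_pos (by omega)), Or.inl (Nat.choose_pos (by omega))]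
  change _ ≤ convSeq m n p q (i + 2)
  generalize convSeq m n p q (i + 1) = x, convSeq m n p q (i + 2) = y at h_sub ⊢
  rw [if_neg (show ¬ p + q ≤ i by omega)] at h_sub
  rcases hipq.eq_or_lt with hipq | hipq
  · simp only [hipq, le_refl, if_true, Nat.sub_self, Nat.choose_zero_right] at h_sub h_pos
    split_ifs at h_sub <;> omega
  · rw [if_neg (show ¬ p + q ≤ i + 1 by omega), if_neg (show ¬ p + q ≤ i + 1 by omega),
      if_neg (show ¬ p + q ≤ i + 1 by omega)] at h_sub
    split_ifs at h_sub <;> omega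

theorem convSeq_unimodal_of_short_handle (m n p q : ℕ)
    (hm : 1 ≤ m) (hn : 1 ≤ n) (hp : 1 ≤ p) (hq : 1 ≤ q)
    (h : q < m ∨ p < n) :
    Unimodal (convSeq m n p q) := by
  obtain ⟨J, h_nonneg, h_nonpos⟩ := singleSignChange_convTailDiff hm hn h
  refine ⟨p + q + 1 + J, by omega, fun i hi hiJ => ?_, fun i hi => ?_⟩
  · rcases le_or_gt i (p + q) with hipq | hipq
    · exact convSeq_le_succ h hi hipq
    · obtain ⟨k, rfl⟩ := Nat.exists_eq_add_of_le (show p + q + 1 ≤ i from hipq)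
      have := h_nonneg k (by omega)
      rw [← convSeq_tail_sub] at this
      omega
  · obtain ⟨k, rfl⟩ := Nat.exists_eq_add_of_le (show p + q + 1 ≤ i by omega)
    have := h_nonpos k (by omega)
    rw [← convSeq_tail_sub] at this
    omega
end
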